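/- arXiv:1212.0294 — 2 statements merged into one kernel-verified Lean document; each statement's English description precedes it below -/
import Mathlib

section
/- Let d ≡ 1 (mod 4) be a positive non-square integer, let ω_d = (1+√d)/2, let l′ be the minimal period of the continued fraction expansion of ω_d, and let p/q = p_{l′−1}/q_{l′−1} be the (l′−1)-th convergent of ω_d. Then ε = (p − q) + q·ω_d satisfies |(2p − q)² − d·q²| = 4 and ε > 1, and ε is the fundamental unit of ℤ[ω_d]: for all integers u, v with |(2u + v)² − d·v²| = 4 and u + v·ω_d > 1, one has u + v·ω_d ≥ ε. -/
/-- The `n`-th total quotient `α_n` of the continued fraction expansion of `θ`: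
`α_0 = θ`, `α_{n+1} = 1/(α_n - ⌊α_n⌋)`. -/
noncomputable def cfAlpha (θ : ℝ) : ℕ → ℝ
  | 0 => θ
  | n + 1 => 1 / Int.fract (cfAlpha θ n)

/-- The `n`-th partial quotient `a_n` of the continued fraction expansion of `θ`. -/
noncomputable def cfA (θ : ℝ) (n : ℕ) : ℤ := ⌊cfAlpha θ n⌋

/-- Numerators of the convergents of `θ`, shifted by two:
`cfP θ (n+2) = p_n`, with `p_{-2} = 0`, `p_{-1} = 1`, `p_n = a_n p_{n-1} + p_{n-2}`. -/
noncomputable def cfP (θ : ℝ) : ℕ → ℤ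
  | 0 => 0
  | 1 => 1
  | n + 2 => cfA θ n * cfP θ (n + 1) + cfP θ n

/-- Denominators of the convergents of `θ`, shifted by two:
`cfQ θ (n+2) = q_n`, with `q_{-2} = 1`, `q_{-1} = 0`, `q_n = a_n q_{n-1} + q_{n-2}`. -/
noncomputable def cfQ (θ : ℝ) : ℕ → ℤ
  | 0 => 1
  | 1 => 0
  | n + 2 => cfA θ n * cfQ θ (n + 1) + cfQ θ n

theorem cfAlpha_irr {x : ℝ} (hx : Irrational x) (n : ℕ) : Irrational (cfAlpha x n) := by
  induction n with
  | zero => simpa [cfAlpha] using hx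
  | succ n ih =>
    have h : Irrational (Int.fract (cfAlpha x n)) := by
      unfold Int.fract
      exact ih.sub_intCast _
    simpa [cfAlpha, one_div] using h.inv

theorem cfFract_pos {x : ℝ} (hx : Irrational x) (n : ℕ) : 0 < Int.fract (cfAlpha x n) := by
  rcases (Int.fract_nonneg (cfAlpha x n)).lt_or_eq with h | h
  · exact h
  · exfalso
    have h2 : cfAlpha x n = ((⌊cfAlpha x n⌋ : ℤ) : ℝ) := by
      have := Int.floor_add_fract (cfAlpha x n)
      linarith
    exact (cfAlpha_irr hx n).ne_int _ h2

theorem cfAlpha_succ_gt {x : ℝ} (hx : Irrational x) (n : ℕ) : 1 < cfAlpha x (n + 1) := by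
  have h1 := cfFract_pos hx n
  have h2 := Int.fract_lt_one (cfAlpha x n)
  simp only [cfAlpha]
  rw [lt_div_iff₀ h1]; linarith

theorem cfA_add {x : ℝ} (hx : Irrational x) (n : ℕ) :
    cfAlpha x n = cfA x n + 1 / cfAlpha x (n + 1) := by
  have h1 := Int.floor_add_fract (cfAlpha x n)
  simp only [cfAlpha, one_div_one_div, cfA]
  linarith

theorem cfA_succ_pos {x : ℝ} (hx : Irrational x) (n : ℕ) : 1 ≤ cfA x (n + 1) := by
  unfold cfA
  rw [Int.le_floor]
  have := cfAlpha_succ_gt hx n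
  push_cast; linarith

theorem cf_main {x : ℝ} (hx : Irrational x) (n : ℕ) :
    x * (cfQ x (n + 1) * cfAlpha x n + cfQ x n) = cfP x (n + 1) * cfAlpha x n + cfP x n := by
  induction n with
  | zero => simp [cfQ, cfP, cfAlpha]
  | succ n ih =>
    have h := cfA_add hx n
    have hp := cfAlpha_succ_gt hx n
    set β := cfAlpha x (n + 1)
    rw [h] at ih
    simp only [cfQ, cfP]
    push_cast
    have hb : β ≠ 0 := by positivity
    field_simp at ih
    linear_combination ih

theorem cf_det (x : ℝ) (n : ℕ) :
    |cfP x (n + 1) * cfQ x n - cfP x n * cfQ x (n + 1)| = 1 := by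
  induction n with
  | zero => simp [cfQ, cfP]
  | succ n ih =>
    rw [← ih, ← abs_neg]
    simp only [cfQ, cfP]
    congr 1; ring

theorem cfAlpha_add (x : ℝ) (m n : ℕ) : cfAlpha x (m + n) = cfAlpha (cfAlpha x m) n := by
  induction n with
  | zero => simp [cfAlpha]
  | succ n ih => rw [← add_assoc]; simp only [cfAlpha, ih]

theorem cf_prod {x : ℝ} (hx : Irrational x) (n : ℕ) :
    2 ≤ cfAlpha x (n + 1) * cfAlpha x (n + 2) := by
  have h1 := cfA_add hx (n + 1)
  have h2 := cfAlpha_succ_gt hx (n + 1)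
  have h3 : (1 : ℝ) ≤ cfA x (n + 1) := by exact_mod_cast cfA_succ_pos hx n
  have h4 : cfAlpha x (n + 1) * cfAlpha x (n + 2)
      = cfA x (n + 1) * cfAlpha x (n + 2) + 1 := by
    rw [h1]; field_simp
  rw [h4]; nlinarith

theorem cf_diff {x y : ℝ} (hx : Irrational x) (hy : Irrational y) (n : ℕ)
    (h : cfA x n = cfA y n) : |cfAlpha x (n + 1) - cfAlpha y (n + 1)|
      = |cfAlpha x n - cfAlpha y n| * (cfAlpha x (n + 1) * cfAlpha y (n + 1)) := by
  have h1 := cfAlpha_succ_gt hx n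
  have h2 := cfAlpha_succ_gt hy n
  rw [cfA_add hx n, cfA_add hy n, h]
  set a := cfAlpha x (n + 1)
  set b := cfAlpha y (n + 1)
  have hab : 0 < a * b := by positivity
  rw [← abs_of_pos hab, ← abs_mul, ← abs_neg]
  congr 1
  have : a ≠ 0 := by positivity
  have : b ≠ 0 := by positivity
  field_simp
  ring

theorem cf_unique {x y : ℝ} (hx : Irrational x) (hy : Irrational y)
    (h : ∀ n, cfA x n = cfA y n) : x = y := by
  by_contra hne
  have hpos : 0 < |cfAlpha x 0 - cfAlpha y 0| := by
    simpa [cfAlpha, sub_eq_zero] using hne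
  have key : ∀ n, 4 ^ n * |cfAlpha x 0 - cfAlpha y 0| ≤
      |cfAlpha x (2 * n) - cfAlpha y (2 * n)| := by
    intro n
    induction n with
    | zero => simp
    | succ n ih =>
      have e1 := cf_diff hx hy (2 * n) (h _)
      have e2 := cf_diff hx hy (2 * n + 1) (h _)
      have p1 := cf_prod hx (2 * n)
      have p2 := cf_prod hy (2 * n)
      have e : 2 * (n + 1) = 2 * n + 1 + 1 := by ring
      rw [e, e2, e1]
      have p3 : 4 ≤ (cfAlpha x (2 * n + 1) * cfAlpha x (2 * n + 2)) *
        (cfAlpha y (2 * n + 1) * cfAlpha y (2 * n + 2)) := by nlinarith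
      have p4 := mul_le_mul ih p3 (by norm_num) (abs_nonneg _)
      calc _ = _ := by rw [pow_succ]; ring
        _ ≤ _ := p4
        _ = _ := by ring
  obtain ⟨n, hn⟩ := pow_unbounded_of_one_lt (1 / |cfAlpha x 0 - cfAlpha y 0|)
    (by norm_num : (1 : ℝ) < 4)
  rw [div_lt_iff₀ hpos] at hn
  have := Int.abs_sub_lt_one_of_floor_eq_floor (h (2 * n))
  linarith [key n]

/-- one backwards step -/
theorem cf_step {x α : ℝ} (hα : 1 < α) (n : ℕ) (a : ℤ) (h : cfAlpha x n = a + 1 / α) :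
    cfA x n = a ∧ cfAlpha x (n + 1) = α := by
  have h0 : 0 < α := by linarith
  have h1 : 1 / α < 1 := by rw [div_lt_one h0]; exact hα
  have h2 : 0 < 1 / α := by positivity
  have hf : ⌊cfAlpha x n⌋ = a := by
    rw [Int.floor_eq_iff, h]; constructor <;> linarith
  refine ⟨hf, ?_⟩
  simp only [cfAlpha, Int.fract, hf]
  rw [h]; simp

theorem cf_conv (x : ℝ) (N : ℕ) : ∀ (p q p' q' : ℤ) (α : ℝ), q'.toNat ≤ N → 1 < α → 1 ≤ q' →
    q' < q → |p * q' - p' * q| = 1 → x * (q * α + q') = p * α + p' →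
    ∃ n, 1 ≤ n ∧ cfAlpha x n = α ∧ cfP x (n + 1) = p ∧ cfQ x (n + 1) = q ∧
      cfP x n = p' ∧ cfQ x n = q' := by
  induction N with
  | zero => intro p q p' q' α h1 _ h2; omega
  | succ N ih =>
    intro p q p' q' α hN hα hq' hq hdet hx
    have hα0 : 0 < α := by linarith
    rcases hq'.eq_or_lt with h1 | h1
    · subst h1
      have hq2 : (2 : ℝ) ≤ q := by exact_mod_cast hq
      rw [abs_eq (by norm_num)] at hdet
      rcases hdet with hdet | hdet
      · have hp : p = p' * q + 1 := by linarith
        subst hp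
        have hβ : 1 < q + 1 / α := by
          have : 0 < 1 / α := by positivity
          linarith
        have hx0 : cfAlpha x 0 = p' + 1 / (q + 1 / α) := by
          have : q * α + 1 ≠ 0 := by positivity
          simp only [cfAlpha]
          push_cast at hx
          field_simp
          linear_combination hx
        obtain ⟨a1, b1⟩ := cf_step hβ 0 p' hx0
        obtain ⟨a2, b2⟩ := cf_step hα 1 q b1
        refine ⟨2, by norm_num, b2, ?_⟩
        simp [cfP, cfQ, a1, a2]
        ring
      · have hp : p = p' * q - 1 := by linarith
        subst hp
        have hi : 0 < 1 / α := by positivity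
        have hγ : 1 < ((q - 1 : ℤ) : ℝ) + 1 / α := by
          push_cast; linarith
        have hβ : 1 < ((1 : ℤ) : ℝ) + 1 / (((q - 1 : ℤ) : ℝ) + 1 / α) := by
          have : 0 < 1 / (((q - 1 : ℤ) : ℝ) + 1 / α) := by positivity
          push_cast at *; linarith
        have hx0 : cfAlpha x 0 = ((p' - 1 : ℤ) : ℝ)
            + 1 / (((1 : ℤ) : ℝ) + 1 / (((q - 1 : ℤ) : ℝ) + 1 / α)) := by
          have h3 : q * α + 1 ≠ 0 := by positivity
          have h4 : 0 < (q - 1) * α + 1 := by nlinarith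
          have h5 : (q - 1) * α + 1 ≠ 0 := h4.ne'
          have h6 : (((q - 1 : ℤ) : ℝ) + 1 / α) = ((q - 1) * α + 1) / α := by
            push_cast; field_simp
          have h7 : (((1 : ℤ) : ℝ) + 1 / (((q - 1) * α + 1) / α))
              = (q * α + 1) / ((q - 1) * α + 1) := by
            push_cast; rw [one_div_div, eq_div_iff h5, add_mul, div_mul_cancel₀ _ h5]; ring
          rw [h6, h7, one_div_div]
          simp only [cfAlpha]
          push_cast at hx ⊢
          field_simp
          linear_combination hx
        obtain ⟨a1, b1⟩ := cf_step hβ 0 _ hx0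
        obtain ⟨a2, b2⟩ := cf_step hγ 1 _ b1
        obtain ⟨a3, b3⟩ := cf_step hα 2 _ b2
        refine ⟨3, by norm_num, b3, ?_⟩
        simp [cfP, cfQ, a1, a2, a3]
        ring
    · -- Euclidean step
      have hdm := Int.mul_ediv_add_emod q q'
      have hr0 := Int.emod_nonneg q (by omega : q' ≠ 0)
      have hr1 := Int.emod_lt_of_pos q (by omega : 0 < q')
      set a := q / q' with ha
      set r := q % q' with hr
      have ha1 : 1 ≤ a := by
        by_contra hcon
        have : a ≤ 0 := by omega
        nlinarith
      have hdet2 : |p' * r - (p - a * p') * q'| = 1 := by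
        rw [← hdet, ← abs_neg]; congr 1; rw [← hdm]; ring
      have hr : 1 ≤ r := by
        by_contra hcon
        have h0 : r = 0 := by omega
        rw [h0] at hdet2
        have : q' ∣ 1 := by
          rw [← hdet2, dvd_abs]
          exact ⟨-(p - a * p'), by ring⟩
        have := Int.le_of_dvd one_pos this
        omega
      have ha1' : (1 : ℝ) ≤ a := by exact_mod_cast ha1
      have hi : 0 < 1 / α := by positivity
      obtain ⟨n, hn, b1, b2, b3, b4, b5⟩ := ih p' q' (p - a * p') r (a + 1 / α) (by omega)
        (by linarith) hr hr1 hdet2 (by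
          have hq : (q : ℝ) = q' * a + r := by exact_mod_cast hdm.symm
          rw [hq] at hx
          push_cast
          field_simp
          linear_combination hx)
      obtain ⟨c1, c2⟩ := cf_step hα n a b1
      refine ⟨n + 1, by omega, c2, ?_, ?_, b2, b3⟩
      · simp only [cfP, c1, b2, b4]; ring
      · simp only [cfQ, c1, b3, b5]; rw [← hdm]; ring

theorem cf_nonneg {x : ℝ} (hx : Irrational x) (h1 : 1 < x) (n : ℕ) :
    1 ≤ cfA x n := by
  cases n with
  | zero =>
    unfold cfA; rw [Int.le_floor]; simpa [cfAlpha] using h1.le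
  | succ n => exact cfA_succ_pos hx n

theorem cf_pos {x : ℝ} (hx : Irrational x) (h1 : 1 < x) (n : ℕ) :
    0 ≤ cfP x n ∧ 0 ≤ cfQ x n ∧ 1 ≤ cfP x (n + 1) ∧ 1 ≤ cfQ x (n + 2) ∧
    cfQ x (n + 1) ≤ cfP x (n + 1) ∧ cfQ x (n + 2) ≤ cfP x (n + 2) ∧ 0 ≤ cfQ x (n + 1) := by
  induction n with
  | zero =>
    have := cf_nonneg hx h1 0
    simp [cfP, cfQ]; omega
  | succ n ih =>
    obtain ⟨i1, i2, i3, i4, i5, i6, i7⟩ := ih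
    have h := cf_nonneg hx h1 n
    have h' := cf_nonneg hx h1 (n + 1)
    have e1 : cfP x (n + 2) = cfA x n * cfP x (n + 1) + cfP x n := rfl
    have e2 : cfP x (n + 3) = cfA x (n + 1) * cfP x (n + 2) + cfP x (n + 1) := rfl
    have e3 : cfQ x (n + 3) = cfA x (n + 1) * cfQ x (n + 2) + cfQ x (n + 1) := rfl
    refine ⟨by omega, by omega, ?_, ?_, i6, ?_, le_trans zero_le_one i4⟩
    · show 1 ≤ cfP x (n + 2)
      nlinarith
    · show 1 ≤ cfQ x (n + 3)
      nlinarith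
    · show cfQ x (n + 3) ≤ cfP x (n + 3)
      rw [e2, e3]; nlinarith

theorem cf_mono {x : ℝ} (hx : Irrational x) (h1 : 1 < x) {m n : ℕ} (h : m ≤ n) :
    cfP x (m + 1) ≤ cfP x (n + 1) ∧ cfQ x (m + 1) ≤ cfQ x (n + 1) := by
  induction h with
  | refl => simp
  | @step n h ih =>
    obtain ⟨i1, i2, i3, i4, i5, i6, i7⟩ := cf_pos hx h1 n
    have h := cf_nonneg hx h1 n
    have e1 : cfP x (n + 2) = cfA x n * cfP x (n + 1) + cfP x n := rfl
    have e2 : cfQ x (n + 2) = cfA x n * cfQ x (n + 1) + cfQ x n := rfl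
    constructor
    · refine ih.1.trans ?_
      show _ ≤ cfP x (n + 2)
      nlinarith
    · refine ih.2.trans ?_
      show _ ≤ cfQ x (n + 2)
      nlinarith

/-- a unit greater than one comes from a convergent -/
theorem cf_unit {x : ℝ} (hx : Irrational x) (h1 : 1 < x) (m u v : ℤ)
    (hxm : x ^ 2 = x + m) (hN : |u ^ 2 + u * v - v ^ 2 * m| = 1) (hv : 1 ≤ v) (hu : 0 ≤ u) :
    ∃ n, 1 ≤ n ∧ (∃ c : ℤ, cfAlpha x n = x + c) ∧ cfP x (n + 1) = u + v ∧ cfQ x (n + 1) = v := by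
  have hu' : (0 : ℝ) ≤ u := by exact_mod_cast hu
  rcases hv.eq_or_lt with h2 | h2
  · subst h2
    rw [abs_eq (by norm_num)] at hN
    have hα : 1 < x + u := by linarith
    have hα0 : x + u ≠ 0 := by linarith
    rcases hN with hN | hN
    · have hN' : (m : ℝ) = u ^ 2 + u - 1 := by
        have : m = u ^ 2 + u - 1 := by linarith
        exact_mod_cast this
      have hu1 : 1 ≤ u := by
        by_contra hcon
        have : u = 0 := by omega
        subst this
        push_cast at hN'
        nlinarith
      have hu1' : (1 : ℝ) ≤ u := by exact_mod_cast hu1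
      have hα2 : 1 < x + u - 1 := by linarith
      have hne : x + u - 1 ≠ 0 := by linarith
      have hβ : 1 < ((1 : ℤ) : ℝ) + 1 / (x + u - 1) := by
        have : 0 < 1 / (x + u - 1) := by positivity
        push_cast; linarith
      have hx0 : cfAlpha x 0 = (u : ℝ) + 1 / (((1 : ℤ) : ℝ) + 1 / (x + u - 1)) := by
        have : ((1 : ℤ) : ℝ) + 1 / (x + u - 1) = (x + u) / (x + u - 1) := by
          push_cast; field_simp; ring
        rw [this, one_div_div]
        simp only [cfAlpha]
        rw [eq_comm, ← eq_sub_iff_add_eq', div_eq_iff hα0]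
        nlinarith
      obtain ⟨a1, b1⟩ := cf_step hβ 0 _ hx0
      obtain ⟨a2, b2⟩ := cf_step hα2 1 _ b1
      refine ⟨2, by norm_num, ⟨u - 1, ?_⟩, ?_⟩
      · rw [b2]; push_cast; ring
      · simp [cfP, cfQ, a1, a2]
    · have hN' : (m : ℝ) = u ^ 2 + u + 1 := by
        have : m = u ^ 2 + u + 1 := by linarith
        exact_mod_cast this
      have hx0 : cfAlpha x 0 = ((u + 1 : ℤ) : ℝ) + 1 / (x + u) := by
        simp only [cfAlpha]
        push_cast
        rw [eq_comm, ← eq_sub_iff_add_eq', div_eq_iff hα0]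
        nlinarith
      obtain ⟨a1, b1⟩ := cf_step hα 0 _ hx0
      refine ⟨1, by norm_num, ⟨u, b1⟩, ?_⟩
      simp [cfP, cfQ, a1]
  · have hdm := Int.mul_ediv_add_emod u v
    have hr0 := Int.emod_nonneg u (by omega : v ≠ 0)
    have hr1 := Int.emod_lt_of_pos u (by omega : 0 < v)
    have hc0 : 0 ≤ u / v := Int.ediv_nonneg hu (by omega)
    set c := u / v with hc
    set r := u % v with hr
    have hc0' : (0 : ℝ) ≤ c := by exact_mod_cast hc0
    have hr2 : 1 ≤ r := by
      by_contra hcon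
      have h0 : r = 0 := by omega
      have huv : v ∣ u := ⟨c, by omega⟩
      have : v ∣ 1 := by
        rw [← hN, dvd_abs]
        obtain ⟨k, hk⟩ := huv
        exact ⟨k * u + u - v * m, by rw [hk]; ring⟩
      have := Int.le_of_dvd one_pos this
      omega
    have hrr : r = u - v * c := by linarith
    obtain ⟨n, hn, b1, b2, b3, b4, b5⟩ := cf_conv x _ (u + v) v (v * m - (u + v) * c) r (x + c)
      le_rfl (by linarith) hr2 hr1 (by
        rw [← hN]; congr 1; rw [hrr]; ring) (by
        rw [hrr]; push_cast
        linear_combination (v : ℝ) * hxm)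
    exact ⟨n, hn, ⟨c, b1⟩, b2, b3⟩

/-- for a positive non-square integer `d ≡ 1 (mod 4)`, `ω_d = (1+√d)/2`, minimal
period `l'` of the continued fraction of `ω_d`, and `(l'-1)`-th convergent `p/q`
(`p = cfP ω_d (l'+1)`, `q = cfQ ω_d (l'+1)`), the number `ε = (p - q) + q ω_d` satisfies
`|(2p - q)² - d q²| = 4`, `ε > 1`, and `ε` is the fundamental unit of `ℤ[ω_d]`:
any `u + v ω_d > 1` (`u, v ∈ ℤ`) with `|(2u + v)² - d v²| = 4` satisfies `u + v ω_d ≥ ε`. -/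
theorem stmt_5 (d : ℕ) (hd : 0 < d) (hns : ¬ IsSquare d) (hd4 : d % 4 = 1) (l' : ℕ)
    (hl : IsLeast {p : ℕ | 0 < p ∧ ∀ n, 1 ≤ n →
      cfA ((1 + Real.sqrt d) / 2) (n + p) = cfA ((1 + Real.sqrt d) / 2) n} l') :
    |(2 * cfP ((1 + Real.sqrt d) / 2) (l' + 1) - cfQ ((1 + Real.sqrt d) / 2) (l' + 1)) ^ 2
        - (d : ℤ) * cfQ ((1 + Real.sqrt d) / 2) (l' + 1) ^ 2| = 4 ∧
    1 < ((cfP ((1 + Real.sqrt d) / 2) (l' + 1) - cfQ ((1 + Real.sqrt d) / 2) (l' + 1) : ℤ) : ℝ)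
        + (cfQ ((1 + Real.sqrt d) / 2) (l' + 1) : ℝ) * ((1 + Real.sqrt d) / 2) ∧
    ∀ u v : ℤ, |(2 * u + v) ^ 2 - (d : ℤ) * v ^ 2| = 4 →
      1 < (u : ℝ) + (v : ℝ) * ((1 + Real.sqrt d) / 2) →
      ((cfP ((1 + Real.sqrt d) / 2) (l' + 1) - cfQ ((1 + Real.sqrt d) / 2) (l' + 1) : ℤ) : ℝ)
          + (cfQ ((1 + Real.sqrt d) / 2) (l' + 1) : ℝ) * ((1 + Real.sqrt d) / 2) ≤
        (u : ℝ) + (v : ℝ) * ((1 + Real.sqrt d) / 2) := by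
  obtain ⟨m, hm⟩ : ∃ m : ℤ, (d : ℤ) = 4 * m + 1 := ⟨d / 4, by omega⟩
  have hmR : (d : ℝ) = 4 * m + 1 := by exact_mod_cast hm
  have hirr : Irrational ((1 + Real.sqrt d) / 2) := by
    have h := irrational_sqrt_natCast_iff.2 hns
    have h2 := (h.natCast_add 1).div_natCast (m := 2) (by norm_num)
    simpa using h2
  have hd1 : 1 < d := by
    rcases Nat.lt_or_ge 1 d with h | h
    · exact h
    · exfalso
      have : d = 1 := by omega
      subst this
      exact hns ⟨1, rfl⟩
  have hs1 : 1 < Real.sqrt d := by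
    rw [Real.lt_sqrt (by norm_num)]; exact_mod_cast (by simpa using hd1)
  have hss : Real.sqrt d ^ 2 = d := Real.sq_sqrt (by positivity)
  set s := Real.sqrt d with hs
  set x := (1 + s) / 2 with hxdef
  have hx1 : 1 < x := by rw [hxdef]; linarith
  have hxm : x ^ 2 = x + m := by
    rw [hxdef]; nlinarith
  clear_value x
  obtain ⟨⟨hl0, hper⟩, hmin⟩ := hl
  -- the tail is periodic
  have htail : cfAlpha x (l' + 1) = cfAlpha x 1 := by
    apply cf_unique (cfAlpha_irr hirr _) (cfAlpha_irr hirr _)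
    intro n
    have := hper (1 + n) (by omega)
    unfold cfA at this ⊢
    rw [← cfAlpha_add, ← cfAlpha_add, ← this]
    congr 2; ring
  have hc : ∃ c : ℤ, cfAlpha x l' = x + c := by
    have e1 := cfA_add hirr l'
    have e0 := cfA_add hirr 0
    rw [htail] at e1
    refine ⟨cfA x l' - cfA x 0, ?_⟩
    have : cfAlpha x 0 = x := rfl
    rw [this] at e0
    push_cast; linarith
  obtain ⟨c, hc⟩ := hc
  have hpos := cf_pos hirr hx1 l'
  have hq1 : 1 ≤ cfQ x (l' + 1) := by
    obtain ⟨k, rfl⟩ : ∃ k, l' = k + 1 := ⟨l' - 1, by omega⟩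
    exact (cf_pos hirr hx1 k).2.2.2.1
  refine ⟨?_, ?_, ?_⟩
  · have hmain := cf_main hirr l'
    have hdet := cf_det x l'
    rw [hc] at hmain
    set p := cfP x (l' + 1)
    set q := cfQ x (l' + 1)
    set p' := cfP x l'
    set q' := cfQ x l'
    have hlin : ((q + q * c + q' - p : ℤ) : ℝ) * x = ((p * c + p' - q * m : ℤ) : ℝ) := by
      push_cast
      linear_combination hmain - (q : ℝ) * hxm
    have hz : q + q * c + q' - p = 0 := by
      by_contra hne
      apply (hirr.intCast_mul hne).ne_int (p * c + p' - q * m)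
      exact hlin
    have hz2 : p * c + p' - q * m = 0 := by
      rw [hz] at hlin
      have : ((p * c + p' - q * m : ℤ) : ℝ) = 0 := by rw [← hlin]; simp
      exact_mod_cast this
    have : (2 * p - q) ^ 2 - (d : ℤ) * q ^ 2 = 4 * (p * q' - p' * q) := by
      rw [hm]
      linear_combination (-4 * p) * hz + 4 * q * hz2
    rw [this, abs_mul, hdet]; norm_num
  · have a1 : (0 : ℝ) ≤ ((cfP x (l' + 1) - cfQ x (l' + 1) : ℤ) : ℝ) := by
      exact_mod_cast (by linarith [hpos.2.2.2.2.1])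
    have a2 : (1 : ℝ) ≤ cfQ x (l' + 1) := by exact_mod_cast hq1
    nlinarith
  · intro u v huv hgt
    have hN : |u ^ 2 + u * v - v ^ 2 * m| = 1 := by
      have : (2 * u + v) ^ 2 - (d : ℤ) * v ^ 2 = 4 * (u ^ 2 + u * v - v ^ 2 * m) := by
        rw [hm]; ring
      rw [this, abs_mul] at huv
      norm_num at huv
      omega
    -- the conjugate
    have hprod : |(u + v * x) * (u + v - v * x)| = 1 := by
      have : ((u : ℝ) + v * x) * (u + v - v * x) = ((u ^ 2 + u * v - v ^ 2 * m : ℤ) : ℝ) := by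
        push_cast; linear_combination (-(v : ℝ) ^ 2) * hxm
      rw [this]; exact_mod_cast hN
    have hconj : |(u : ℝ) + v - v * x| < 1 := by
      rw [abs_mul, abs_of_pos (by linarith)] at hprod
      by_contra hcon
      push Not at hcon
      nlinarith
    rw [abs_lt] at hconj
    have hv : 1 ≤ v := by
      by_contra hcon
      have : v ≤ 0 := by omega
      have : (v : ℝ) ≤ 0 := by exact_mod_cast this
      nlinarith
    have hv' : (1 : ℝ) ≤ v := by exact_mod_cast hv
    have hu : 0 ≤ u := by
      have : (-1 : ℝ) < u := by nlinarith
      have : -1 < u := by exact_mod_cast this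
      omega
    obtain ⟨n, hn, ⟨k, hk⟩, hp, hq⟩ := cf_unit hirr hx1 m u v hxm hN hv hu
    have hn1 : cfAlpha x (n + 1) = cfAlpha x 1 := by
      simp only [cfAlpha, hk, Int.fract_add_intCast]
    have hle : l' ≤ n := by
      apply hmin
      refine ⟨by omega, ?_⟩
      intro j hj
      obtain ⟨i, rfl⟩ : ∃ i, j = 1 + i := ⟨j - 1, by omega⟩
      unfold cfA
      have e : 1 + i + n = (n + 1) + i := by ring
      rw [e, cfAlpha_add, cfAlpha_add x 1 i, hn1]
    obtain ⟨m1, m2⟩ := cf_mono hirr hx1 hle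
    rw [hp] at m1
    rw [hq] at m2
    have m1' : (cfP x (l' + 1) : ℝ) ≤ u + v := by exact_mod_cast m1
    have m2' : (cfQ x (l' + 1) : ℝ) ≤ v := by exact_mod_cast m2
    push_cast
    nlinarith
end

section
/- Let a_1, …, a_m be positive integers, and let q_m and q_{m−1} be the denominators (in lowest terms) of the finite continued fractions [0; a_1, …, a_m] and [0; a_1, …, a_{m−1}] respectively. For N ≥ 1 let f¹(N) be the number of positive non-square integers d ≤ N with d ≡ 1 (mod 4) such that the simple continued fraction expansion of ω_d = (1+√d)/2 has i-th partial quotient equal to a_i for every 1 ≤ i ≤ m. Then lim_{N→∞} 4·f¹(N)/N = 1/(q_m·(q_m + q_{m−1})). -/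
/-- `cfTail a m j` is the finite continued fraction `[a_{m-j+1}; a_{m-j+2}, …, a_m]` as a
rational number, so that `cfTail a m m = [a_1; a_2, …, a_m]` (and `cfTail a m 0 = 0`).
In particular `[0; a_1, …, a_m] = (cfTail a m m)⁻¹`. -/
def cfTail (a : ℕ → ℕ) (m : ℕ) : ℕ → ℚ
  | 0 => 0
  | j + 1 => a (m - j) + (cfTail a m j)⁻¹

open Filter

theorem aux_alpha_shift (θ : ℝ) (n : ℕ) :
    cfAlpha θ (n + 1) = cfAlpha (1 / Int.fract θ) n := by
  induction n with
  | zero => rfl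
  | succ n ih =>
    rw [cfAlpha, ih, cfAlpha]

theorem aux_tail_shift (a : ℕ → ℕ) (m : ℕ) : ∀ j, j ≤ m →
    cfTail a (m + 1) j = cfTail (fun i => a (i + 1)) m j := by
  intro j
  induction j with
  | zero => intro _; rfl
  | succ j ih =>
    intro h
    rw [cfTail, cfTail, ih (by omega)]
    have : m + 1 - j = m - j + 1 := by omega
    rw [this]

/-- The explicit linear description of a continued fraction cylinder. -/
theorem aux_cyl (m : ℕ) : ∀ (a : ℕ → ℕ), (∀ i, 1 ≤ i → i ≤ m → 0 < a i) →
    ∃ p p' q q' e : ℤ, 0 ≤ p ∧ 0 ≤ p' ∧ 0 < q ∧ 0 ≤ q' ∧ p ≤ q ∧ p + p' ≤ q + q' ∧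
      (1 ≤ m → 0 < q') ∧ (m = 0 → q' = 0) ∧
      (e = 1 ∨ e = -1) ∧ p * q' - p' * q = e ∧
      (p : ℚ) / q = (cfTail a m m)⁻¹ ∧
      (1 ≤ m → (p' : ℚ) / q' = (cfTail a (m - 1) (m - 1))⁻¹) ∧
      ∀ θ : ℝ, Irrational θ → ((∀ i, 1 ≤ i → i ≤ m → cfA θ i = (a i : ℤ)) ↔
        (0 < (e : ℝ) * (p - q * Int.fract θ) ∧
          0 < (e : ℝ) * ((q + q') * Int.fract θ - (p + p')))) := by
  induction m with
  | zero =>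
    intro a _
    refine ⟨0, 1, 1, 0, -1, by simp, by simp, by simp, by simp, by simp, by simp, by simp, by simp,
      by simp, by simp, by simp [cfTail], by simp, ?_⟩
    intro θ hθ
    have h0 : 0 < Int.fract θ := by
      rcases (Int.fract_nonneg θ).lt_or_eq with h | h
      · exact h
      · exfalso
        have := Int.fract_eq_zero_iff.1 h.symm
        obtain ⟨z, hz⟩ := this
        exact hθ ⟨z, by simpa using hz⟩
    have h1 := Int.fract_lt_one θ
    constructor
    · intro _
      push_cast
      constructor <;> linarith
    · intro _ i h1 h2
      omega
  | succ m ih =>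
    intro a ha
    obtain ⟨p, p', q, q', e, hp, hp', hq, hq', hpq, hpq', hq'0, hq'z, he, hdet, h1, h2, h3⟩ :=
      ih (fun i => a (i + 1)) (fun i h1 h2 => ha (i + 1) (by omega) (by omega))
    have ha1 : 0 < (a 1 : ℤ) := by exact_mod_cast ha 1 le_rfl (by omega)
    have hq'new : 0 < (a 1 : ℤ) * q' + p' := by
      rcases Nat.eq_zero_or_pos m with h | h
      · rcases hq'.lt_or_eq with h' | h'
        · nlinarith [mul_pos ha1 h']
        · have : p' ≠ 0 := by
            rintro rfl
            rw [← h'] at hdet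
            rcases he with he | he <;> simp [he] at hdet
          rw [← h']
          omega
      · nlinarith [mul_pos ha1 (hq'0 h)]
    refine ⟨q, q', a 1 * q + p, a 1 * q' + p', -e, hq.le, hq', by nlinarith [mul_pos ha1 hq],
      by nlinarith [mul_nonneg ha1.le hq'], by nlinarith, by nlinarith, fun _ => hq'new,
      by omega,
      by rcases he with h | h <;> simp [h], by rw [← hdet]; ring, ?_, ?_, ?_⟩
    · have hqQ : (0 : ℚ) < q := by exact_mod_cast hq
      rw [cfTail, aux_tail_shift a m m le_rfl, ← h1]
      have : m + 1 - m = 1 := by omega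
      rw [this]
      push_cast
      have e : (a 1 : ℚ) + ((p : ℚ) / q) = (a 1 * q + p) / q := by field_simp
      rw [e, inv_div]
    · intro _
      rcases Nat.eq_zero_or_pos m with h | h
      · subst h
        have : q' = 0 := hq'z rfl
        simp [this, cfTail]
      · obtain ⟨k, rfl⟩ : ∃ k, m = k + 1 := ⟨m - 1, by omega⟩
        have h2 := h2 h
        have hqQ : (0 : ℚ) < q' := by exact_mod_cast hq'0 h
        simp only [Nat.add_sub_cancel] at h2 ⊢
        rw [cfTail, aux_tail_shift a k k le_rfl, ← h2]
        have : k + 1 - k = 1 := by omega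
        rw [this]
        push_cast
        have e : (a 1 : ℚ) + ((p' : ℚ) / q') = (a 1 * q' + p') / q' := by field_simp
        rw [e, inv_div]
    · intro θ hθ
      have hx0 : 0 < Int.fract θ := by
        rcases (Int.fract_nonneg θ).lt_or_eq with h | h
        · exact h
        · exfalso
          have := Int.fract_eq_zero_iff.1 h.symm
          obtain ⟨z, hz⟩ := this
          exact hθ ⟨z, by simpa using hz⟩
      have hirr : Irrational (1 / Int.fract θ) := by
        rw [one_div, irrational_inv_iff]
        exact hθ.sub_intCast ⌊θ⌋
      have key := h3 _ hirr
      set x := Int.fract θ with hx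
      have hsplit : (∀ i, 1 ≤ i → i ≤ m + 1 → cfA θ i = (a i : ℤ)) ↔
          (⌊1 / x⌋ = (a 1 : ℤ) ∧
            ∀ i, 1 ≤ i → i ≤ m → cfA (1 / x) i = (a (i + 1) : ℤ)) := by
        constructor
        · intro h
          refine ⟨h 1 le_rfl (by omega), fun i h1 h2 => ?_⟩
          rw [← h (i + 1) (by omega) (by omega), cfA, cfA, aux_alpha_shift]
        · rintro ⟨h, h'⟩ i h1 h2
          obtain ⟨j, rfl⟩ : ∃ j, i = j + 1 := ⟨i - 1, by omega⟩
          rcases Nat.eq_zero_or_pos j with hj | hj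
          · subst hj; exact h
          · rw [← h' j hj (by omega), cfA, cfA, aux_alpha_shift]
      have e1 : (((-e : ℤ)) : ℝ) * ((q : ℝ) - ((a 1 * q + p : ℤ) : ℝ) * x) =
          x * ((e : ℝ) * (p - q * (1 / x - a 1))) := by
        push_cast; field_simp; ring
      have e2 : (((-e : ℤ)) : ℝ) * (((a 1 * q + p : ℤ) + (a 1 * q' + p' : ℤ) : ℝ) * x
            - (q + q')) =
          x * ((e : ℝ) * ((q + q') * (1 / x - a 1) - (p + p'))) := by
        push_cast; field_simp; ring
      rw [hsplit, key, e1, e2, mul_pos_iff_of_pos_left hx0, mul_pos_iff_of_pos_left hx0]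
      constructor
      · rintro ⟨hf, hA, hB⟩
        have : Int.fract (1 / x) = 1 / x - a 1 := by
          rw [Int.fract, hf]; push_cast; rfl
        rw [this] at hA hB
        exact ⟨hA, hB⟩
      · rintro ⟨hA, hB⟩
        have hf : ⌊1 / x⌋ = (a 1 : ℤ) := by
          rw [Int.floor_eq_iff]
          push_cast
          have hqR : (0 : ℝ) < q := by exact_mod_cast hq
          have hqR' : (0 : ℝ) ≤ q' := by exact_mod_cast hq'
          have hpR : (0 : ℝ) ≤ p := by exact_mod_cast hp
          have hpR' : (0 : ℝ) ≤ p' := by exact_mod_cast hp'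
          have hpqR : (p : ℝ) ≤ q := by exact_mod_cast hpq
          have hpqR' : (p : ℝ) + p' ≤ q + q' := by exact_mod_cast hpq'
          suffices h : 0 ≤ 1 / x - (a 1 : ℝ) ∧ 1 / x - (a 1 : ℝ) < 1 by
            constructor <;> linarith [h.1, h.2]
          generalize 1 / x - (a 1 : ℝ) = y at hA hB
          rcases he with h | h <;> rw [h] at hA hB <;> push_cast at hA hB <;> constructor <;>
            by_contra hc <;> push Not at hc <;> nlinarith
        have : Int.fract (1 / x) = 1 / x - a 1 := by
          rw [Int.fract, hf]; push_cast; rfl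
        rw [this]
        exact ⟨hf, hA, hB⟩

theorem aux_den (p q : ℤ) (hq : 0 < q) (u v : ℤ) (h : u * p + v * q = 1) :
    (((p : ℚ) / q).den : ℝ) = q := by
  have hc : IsCoprime p q := ⟨u, v, h⟩
  have := Rat.den_div_eq_of_coprime hq (Int.isCoprime_iff_gcd_eq_one.1 hc)
  exact_mod_cast this

/-- the block count -/
theorem aux_block (l u : ℝ) (hl : 0 ≤ l) (hlu : l < u) (hu : u ≤ 1) (K : ℕ) :
    |((((Finset.Ico (K ^ 2 + K) ((K + 1) ^ 2 + (K + 1))).filter fun n : ℕ =>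
      Int.fract ((1 + Real.sqrt (4 * n + 1 : ℕ)) / 2) ∈ Set.Ioo l u).card : ℝ)) -
      (u - l) * (2 * (K + 1))| ≤ 2 := by
  set A : ℝ := ((K : ℝ) + 1 + l) ^ 2 - (K + 1 + l) with hA
  set B : ℝ := ((K : ℝ) + 1 + u) ^ 2 - (K + 1 + u) with hB
  have hK : (0 : ℝ) ≤ K := K.cast_nonneg
  have hA0 : 0 ≤ A := by rw [hA]; nlinarith
  have hAB : A < B := by rw [hA, hB]; nlinarith
  have hset : ((Finset.Ico (K ^ 2 + K) ((K + 1) ^ 2 + (K + 1))).filter fun n : ℕ =>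
      Int.fract ((1 + Real.sqrt (4 * n + 1 : ℕ)) / 2) ∈ Set.Ioo l u) =
      Finset.Ioo ⌊A⌋₊ ⌈B⌉₊ := by
    ext n
    rw [Finset.mem_filter, Finset.mem_Ico, Finset.mem_Ioo, Nat.floor_lt hA0, Nat.lt_ceil]
    set w : ℝ := (1 + Real.sqrt (4 * n + 1 : ℕ)) / 2 with hw
    have hw1 : 1 ≤ w := by
      have : (1 : ℝ) ≤ Real.sqrt (4 * n + 1 : ℕ) := by
        rw [Real.one_le_sqrt]; push_cast; nlinarith [(n.cast_nonneg : (0 : ℝ) ≤ n)]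
      rw [hw]; linarith
    have hwn : w ^ 2 - w = n := by
      have : Real.sqrt (4 * n + 1 : ℕ) ^ 2 = (4 * n + 1 : ℕ) := Real.sq_sqrt (Nat.cast_nonneg _)
      push_cast at this
      rw [hw]; push_cast; nlinarith
    have hfl : ∀ t : ℝ, 0 ≤ t → (((K : ℝ) + 1 + t) ^ 2 - (K + 1 + t) < n ↔ K + 1 + t < w) := by
      intro t ht
      rw [← hwn]
      constructor
      · intro h; by_contra hc; push Not at hc; nlinarith
      · intro h; nlinarith
    have hfl' : ∀ t : ℝ, 0 ≤ t → ((n : ℝ) < ((K : ℝ) + 1 + t) ^ 2 - (K + 1 + t) ↔ w < K + 1 + t) := by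
      intro t ht
      rw [← hwn]
      constructor
      · intro h; by_contra hc; push Not at hc; nlinarith
      · intro h; nlinarith
    rw [hA, hB, hfl l hl, hfl' u (by linarith)]
    constructor
    · rintro ⟨⟨h1, h2⟩, h3, h4⟩
      have h1' : (K : ℝ) + 1 ≤ w := by
        have h := (hfl' 0 le_rfl).not
        push Not at h
        have := h.1 (by
          have : ((K ^ 2 + K : ℕ) : ℝ) ≤ n := by exact_mod_cast h1
          push_cast at this; nlinarith)
        linarith
      have h2' : w < K + 1 + 1 := (hfl' 1 zero_le_one).1 (by
          have : (n : ℝ) < (((K + 1) ^ 2 + (K + 1) : ℕ) : ℝ) := by exact_mod_cast h2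
          push_cast at this; nlinarith)
      have hf : ⌊w⌋ = (K : ℤ) + 1 := by
        rw [Int.floor_eq_iff]; push_cast; exact ⟨h1', h2'⟩
      rw [Int.fract, hf] at h3 h4
      push_cast at h3 h4
      constructor <;> linarith
    · rintro ⟨h1, h2⟩
      have hf : ⌊w⌋ = (K : ℤ) + 1 := by
        rw [Int.floor_eq_iff]; push_cast; constructor <;> linarith
      refine ⟨⟨?_, ?_⟩, ?_⟩
      · have : ((K ^ 2 + K : ℕ) : ℝ) ≤ n := by push_cast; nlinarith
        exact_mod_cast this
      · have : (n : ℝ) < (((K + 1) ^ 2 + (K + 1) : ℕ) : ℝ) := by push_cast; nlinarith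
        exact_mod_cast this
      · rw [Int.fract, hf]
        push_cast
        constructor <;> linarith
  rw [hset, Nat.card_Ioo]
  have f1 := Nat.floor_le hA0
  have f2 := Nat.lt_floor_add_one A
  have c1 := Nat.le_ceil B
  have c2 := Nat.ceil_lt_add_one (hA0.trans hAB.le)
  have hle : ⌊A⌋₊ + 1 ≤ ⌈B⌉₊ := by
    have : (⌊A⌋₊ : ℝ) < ⌈B⌉₊ := by linarith
    exact_mod_cast this
  rw [Nat.sub_sub, Nat.cast_sub hle]
  push_cast
  have hBA : B - A = (u - l) * (2 * (K + 1)) + (u - l) * (u + l - 1) := by rw [hA, hB]; ring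
  have h5 : (u - l) * (u + l - 1) ≤ 1 := by nlinarith
  have h6 : -1 ≤ (u - l) * (u + l - 1) := by nlinarith
  rw [abs_le]
  constructor <;> linarith

theorem aux_filter_lip (P : ℕ → Prop) [DecidablePred P] (s t : ℕ) (h : s ≤ t) :
    ((Finset.range t).filter P).card =
      ((Finset.range s).filter P).card + ((Finset.Ico s t).filter P).card := by
  rw [← Finset.card_union_of_disjoint, ← Finset.filter_union]
  · congr 2
    ext n; simp; omega
  · apply Finset.disjoint_filter_filter
    rw [Finset.disjoint_left]
    intro n; simp; omega

theorem aux_count (l u : ℝ) (hl : 0 ≤ l) (hlu : l < u) (hu : u ≤ 1) (K : ℕ) :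
    |((((Finset.range (K ^ 2 + K)).filter fun n : ℕ =>
      Int.fract ((1 + Real.sqrt (4 * n + 1 : ℕ)) / 2) ∈ Set.Ioo l u).card : ℝ)) -
      (u - l) * (K ^ 2 + K)| ≤ 2 * K := by
  induction K with
  | zero => simp
  | succ K ih =>
    rw [aux_filter_lip _ (K ^ 2 + K) _ (by nlinarith)]
    have := aux_block l u hl hlu hu K
    rw [abs_le] at *
    push_cast at *
    constructor <;> nlinarith

theorem aux_count' (l u : ℝ) (hl : 0 ≤ l) (hlu : l < u) (hu : u ≤ 1) (M : ℕ) :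
    |((((Finset.range M).filter fun n : ℕ =>
      Int.fract ((1 + Real.sqrt (4 * n + 1 : ℕ)) / 2) ∈ Set.Ioo l u).card : ℝ)) -
      (u - l) * M| ≤ 4 * Real.sqrt M := by
  set K := Nat.sqrt M with hK
  have hK1 : K ^ 2 ≤ M := Nat.sqrt_le' M
  have hK2 : M ≤ K ^ 2 + 2 * K := by
    have := Nat.lt_succ_sqrt' M
    simp only [Nat.succ_eq_add_one, ← hK] at this
    nlinarith
  have hKs : (K : ℝ) ≤ Real.sqrt M := Real.nat_sqrt_le_real_sqrt
  have hc := aux_count l u hl hlu hu K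
  have hu1 : u - l ≤ 1 := by linarith
  refine le_trans ?_ (mul_le_mul_of_nonneg_left hKs (by norm_num))
  have hK1' : (K : ℝ) ^ 2 ≤ M := by exact_mod_cast hK1
  have hK2' : (M : ℝ) ≤ K ^ 2 + 2 * K := by exact_mod_cast hK2
  rcases le_total M (K ^ 2 + K) with h | h
  · have h' : (M : ℝ) ≤ K ^ 2 + K := by exact_mod_cast h
    rw [aux_filter_lip _ M _ h] at hc
    have hle := Finset.card_filter_le (Finset.Ico M (K ^ 2 + K)) fun n : ℕ =>
      Int.fract ((1 + Real.sqrt (4 * n + 1 : ℕ)) / 2) ∈ Set.Ioo l u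
    rw [Nat.card_Ico] at hle
    have hle2 := hle.trans (show K ^ 2 + K - M ≤ K by omega)
    rw [← Nat.cast_le (α := ℝ)] at hle2
    have hnn := Nat.cast_nonneg (α := ℝ) ((Finset.Ico M (K ^ 2 + K)).filter fun n : ℕ =>
      Int.fract ((1 + Real.sqrt (4 * n + 1 : ℕ)) / 2) ∈ Set.Ioo l u).card
    rw [Nat.cast_add] at hc
    rw [abs_le] at *
    constructor <;> nlinarith
  · have h' : (K : ℝ) ^ 2 + K ≤ M := by exact_mod_cast h
    rw [aux_filter_lip _ _ _ h]
    have hle := Finset.card_filter_le (Finset.Ico (K ^ 2 + K) M) fun n : ℕ =>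
      Int.fract ((1 + Real.sqrt (4 * n + 1 : ℕ)) / 2) ∈ Set.Ioo l u
    rw [Nat.card_Ico] at hle
    have hle2 := hle.trans (show M - (K ^ 2 + K) ≤ K by omega)
    rw [← Nat.cast_le (α := ℝ)] at hle2
    have hnn := Nat.cast_nonneg (α := ℝ) ((Finset.Ico (K ^ 2 + K) M).filter fun n : ℕ =>
      Int.fract ((1 + Real.sqrt (4 * n + 1 : ℕ)) / 2) ∈ Set.Ioo l u).card
    rw [Nat.cast_add]
    rw [abs_le] at *
    constructor <;> nlinarith

theorem aux_tendsto (l u : ℝ) (hl : 0 ≤ l) (hlu : l < u) (hu : u ≤ 1) :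
    Tendsto (fun N : ℕ => 4 * ((((Finset.range ((N + 3) / 4)).filter fun n : ℕ =>
      Int.fract ((1 + Real.sqrt (4 * n + 1 : ℕ)) / 2) ∈ Set.Ioo l u).card : ℝ)) / N)
      atTop (nhds (u - l)) := by
  rw [tendsto_iff_dist_tendsto_zero]
  have hlim : Tendsto (fun N : ℕ => 19 * (Real.sqrt N)⁻¹) atTop (nhds 0) := by
    have : Tendsto (fun N : ℕ => Real.sqrt N) atTop atTop :=
      Real.tendsto_sqrt_atTop.comp tendsto_natCast_atTop_atTop
    simpa using this.inv_tendsto_atTop.const_mul 19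
  refine squeeze_zero' (Eventually.of_forall fun _ => dist_nonneg) ?_ hlim
  filter_upwards [eventually_ge_atTop 1] with N hN
  have hc := aux_count' l u hl hlu hu ((N + 3) / 4)
  have hM1 : (N : ℝ) ≤ 4 * (((N + 3) / 4 : ℕ) : ℝ) := by
    exact_mod_cast (show N ≤ 4 * ((N + 3) / 4) by omega)
  have hM2 : 4 * (((N + 3) / 4 : ℕ) : ℝ) ≤ N + 3 := by
    exact_mod_cast (show 4 * ((N + 3) / 4) ≤ N + 3 by omega)
  have hM3 : (((N + 3) / 4 : ℕ) : ℝ) ≤ N := by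
    exact_mod_cast (show (N + 3) / 4 ≤ N by omega)
  have hs := Real.sqrt_le_sqrt hM3
  have hN1 : (1 : ℝ) ≤ N := by exact_mod_cast hN
  have hs1 : 1 ≤ Real.sqrt N := Real.one_le_sqrt.2 hN1
  have hss : Real.sqrt N * Real.sqrt N = N := Real.mul_self_sqrt (by linarith)
  generalize ((((Finset.range ((N + 3) / 4)).filter fun n : ℕ =>
      Int.fract ((1 + Real.sqrt (4 * n + 1 : ℕ)) / 2) ∈ Set.Ioo l u).card : ℝ)) = A at *
  generalize (((N + 3) / 4 : ℕ) : ℝ) = M at *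
  have e : 4 * A / N - (u - l) = (4 * A - (u - l) * N) / N := by field_simp
  have e' : 19 * (Real.sqrt N)⁻¹ = 19 * Real.sqrt N / N := by
    rw [eq_div_iff (by linarith)]
    nth_rewrite 2 [← hss]
    field_simp
  rw [Real.dist_eq, e, e', abs_div, abs_of_pos (show (0 : ℝ) < N by linarith)]
  gcongr
  rw [abs_le] at *
  constructor <;> nlinarith

theorem aux_irr (d : ℕ) (hd : ¬ IsSquare d) : Irrational ((1 + Real.sqrt d) / 2) := by
  have h : Irrational (Real.sqrt d) := by
    rw [irrational_sqrt_natCast_iff]; exact hd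
  have := (h.natCast_add 1).div_natCast (m := 2) (by norm_num)
  simpa using this

theorem aux_sq (d : ℕ) (hd : IsSquare d) (h4 : d % 4 = 1) :
    Int.fract ((1 + Real.sqrt d) / 2) = 0 := by
  obtain ⟨r, rfl⟩ := hd
  have hr : r % 2 = 1 := by
    rcases Nat.mod_two_eq_zero_or_one r with h | h
    · exfalso
      obtain ⟨k, rfl⟩ : ∃ k, r = 2 * k := ⟨r / 2, by omega⟩
      have : 2 * k * (2 * k) = 4 * (k * k) := by ring
      omega
    · exact h
  obtain ⟨k, rfl⟩ : ∃ k, r = 2 * k + 1 := ⟨r / 2, by omega⟩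
  have : (1 + Real.sqrt ((2 * k + 1) * (2 * k + 1) : ℕ)) / 2 = ((k + 1 : ℕ) : ℝ) := by
    rw [Nat.cast_mul, Real.sqrt_mul_self (Nat.cast_nonneg _)]
    push_cast; ring
  rw [this, Int.fract_natCast]

/-- for positive integers `a_1, …, a_m`, with `q_m` and `q_{m-1}` the denominators
in lowest terms of `[0; a_1,…,a_m]` and `[0; a_1,…,a_{m-1}]`, the number `f¹(N)` of positive
non-square `d ≤ N` with `d ≡ 1 (mod 4)` whose continued fraction of `ω_d = (1+√d)/2` has `i`-th
partial quotient `a_i` for all `1 ≤ i ≤ m` satisfies `4 f¹(N)/N → 1/(q_m (q_m + q_{m-1}))`. -/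
theorem stmt_9 (m : ℕ) (hm : 1 ≤ m) (a : ℕ → ℕ) (ha : ∀ i, 1 ≤ i → i ≤ m → 0 < a i) :
    Filter.Tendsto
      (fun N : ℕ =>
        (4 * ({d : ℕ | 0 < d ∧ d ≤ N ∧ ¬ IsSquare d ∧ d % 4 = 1 ∧
            ∀ i, 1 ≤ i → i ≤ m →
              cfA ((1 + Real.sqrt d) / 2) i = (a i : ℤ)}.ncard : ℝ) / N))
      Filter.atTop
      (nhds (1 / ((((cfTail a m m)⁻¹).den : ℝ) *
        ((((cfTail a m m)⁻¹).den : ℝ) + (((cfTail a (m - 1) (m - 1))⁻¹).den : ℝ))))) := by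
  obtain ⟨p, p', q, q', e, hp, hp', hq, hq', hpq, hpq', hq'0, hq'z, he, hdet, h1, h2, h3⟩ := aux_cyl m a ha
  have hq'1 := hq'0 hm
  have hee : e * e = 1 := by rcases he with h | h <;> simp [h]
  rw [← h1, ← h2 hm, aux_den p q hq (e * q') (-e * p') (by linear_combination e * hdet + hee),
    aux_den p' q' hq'1 (-e * q) (e * p) (by linear_combination e * hdet + hee)]
  have hqR : (0 : ℝ) < q := by exact_mod_cast hq
  have hqR' : (0 : ℝ) < q' := by exact_mod_cast hq'1
  have hpR : (0 : ℝ) ≤ p := by exact_mod_cast hp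
  have hpR' : (0 : ℝ) ≤ p' := by exact_mod_cast hp'
  have hpqR : (p : ℝ) ≤ q := by exact_mod_cast hpq
  have hpqR' : (p : ℝ) + p' ≤ q + q' := by exact_mod_cast hpq'
  have hdetR : (p : ℝ) * q' - p' * q = e := by exact_mod_cast hdet
  obtain ⟨l, u, hl, hlu, hu, hdiff, hcond⟩ : ∃ l u : ℝ, 0 ≤ l ∧ l < u ∧ u ≤ 1 ∧
      u - l = 1 / ((q : ℝ) * (q + q')) ∧ ∀ x : ℝ, (0 < (e : ℝ) * (p - q * x) ∧
          0 < (e : ℝ) * ((q + q') * x - (p + p'))) ↔ x ∈ Set.Ioo l u := by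
    have hs : (0 : ℝ) < q + q' := by linarith
    rcases he with h | h
    · subst h
      have hd : (p : ℝ) / q - (p + p') / (q + q') = 1 / ((q : ℝ) * (q + q')) := by
        push_cast at hdetR
        field_simp
        linarith
      refine ⟨(p + p') / (q + q'), p / q, by positivity, ?_, (div_le_one hqR).2 hpqR, hd, ?_⟩
      · have : 0 < 1 / ((q : ℝ) * (q + q')) := by positivity
        linarith
      · intro x
        rw [Set.mem_Ioo, div_lt_iff₀ hs, lt_div_iff₀ hqR]
        push_cast
        constructor <;> rintro ⟨h1, h2⟩ <;> constructor <;> linarith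
    · subst h
      have hd : (p + p' : ℝ) / (q + q') - p / q = 1 / ((q : ℝ) * (q + q')) := by
        push_cast at hdetR
        field_simp
        linarith
      refine ⟨p / q, (p + p') / (q + q'), by positivity, ?_, (div_le_one hs).2 hpqR', hd, ?_⟩
      · have : 0 < 1 / ((q : ℝ) * (q + q')) := by positivity
        linarith
      · intro x
        rw [Set.mem_Ioo, div_lt_iff₀ hqR, lt_div_iff₀ hs]
        push_cast
        constructor <;> rintro ⟨h1, h2⟩ <;> constructor <;> linarith
  rw [← hdiff]
  refine (aux_tendsto l u hl hlu hu).congr fun N => ?_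
  congr 3
  rw [← Set.ncard_coe_finset, ← Set.ncard_image_of_injective _
    (show Function.Injective (fun n : ℕ => 4 * n + 1) from fun x y h => by
      simp only at h; omega)]
  congr 1
  ext d
  simp only [Set.mem_image, Finset.mem_coe, Finset.mem_filter, Finset.mem_range, Set.mem_setOf_eq]
  constructor
  · rintro ⟨n, ⟨hn, hx⟩, rfl⟩
    have hns : ¬ IsSquare (4 * n + 1) := by
      intro hsq
      rw [aux_sq _ hsq (by omega)] at hx
      exact absurd hx.1 (not_lt.2 hl)
    exact ⟨by omega, by omega, hns, by omega,
      (h3 _ (aux_irr _ hns)).2 ((hcond _).2 hx)⟩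
  · rintro ⟨h0, hN, hns, h4, hA⟩
    have hd : 4 * (d / 4) + 1 = d := by omega
    refine ⟨d / 4, ⟨by omega, ?_⟩, hd⟩
    rw [hd]
    exact (hcond _).1 ((h3 _ (aux_irr _ hns)).1 hA)
end
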